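/- Let n ≥ 1, let Q = 2n + 2, and let α ∈ ℝ. Then for every real-valued φ ∈ C_c^∞(ℝ^{2n+1} \ {0}), ∫_{ℝ^{2n+1}} ρ^α |∇_ℍ φ|² dz dt ≥ ((Q + α − 2)/2)² ∫_{ℝ^{2n+1}} ρ^{α−4} |z|² φ² dz dt. -/

import Mathlib

open MeasureTheory Real

noncomputable section

/-- The underlying space of the Heisenberg group ℍⁿ, identified with ℝ^{2n+1}:
points `(x, y, t)` with `x y : Fin n → ℝ`, `t : ℝ`; write `z = (x, y)`. -/
abbrev Hspace (n : ℕ) : Type := (Fin n → ℝ) × (Fin n → ℝ) × ℝ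

/-- The horizontal vector field `X_j f = ∂f/∂x_j + 2 y_j ∂f/∂t`. -/
def Xd (n : ℕ) (j : Fin n) (f : Hspace n → ℝ) (p : Hspace n) : ℝ :=
  fderiv ℝ f p (Pi.single j 1, 0, 0) + 2 * p.2.1 j * fderiv ℝ f p (0, 0, 1)

/-- The horizontal vector field `Y_j f = ∂f/∂y_j − 2 x_j ∂f/∂t`. -/
def Yd (n : ℕ) (j : Fin n) (f : Hspace n → ℝ) (p : Hspace n) : ℝ :=
  fderiv ℝ f p (0, Pi.single j 1, 0) - 2 * p.1 j * fderiv ℝ f p (0, 0, 1)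

/-- Squared length of the horizontal gradient: `|∇_ℍ f|² = Σ_j ((X_j f)² + (Y_j f)²)`. -/
def gradH2 (n : ℕ) (f : Hspace n → ℝ) (p : Hspace n) : ℝ :=
  ∑ j : Fin n, ((Xd n j f p) ^ 2 + (Yd n j f p) ^ 2)

/-- The Kohn sub-Laplacian `Δ_ℍ f = Σ_j (X_j(X_j f) + Y_j(Y_j f))`. -/
def lapH (n : ℕ) (f : Hspace n → ℝ) (p : Hspace n) : ℝ :=
  ∑ j : Fin n, (Xd n j (Xd n j f) p + Yd n j (Yd n j f) p)

/-- `|z|² = |x|² + |y|²`. -/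
def zSq (n : ℕ) (p : Hspace n) : ℝ := ∑ j : Fin n, ((p.1 j) ^ 2 + (p.2.1 j) ^ 2)

/-- The homogeneous norm `ρ(z, t) = (|z|⁴ + t²)^{1/4}`. -/
def rho (n : ℕ) (p : Hspace n) : ℝ := ((zSq n p) ^ 2 + p.2.2 ^ 2) ^ ((4 : ℝ)⁻¹)


lemma Xd_eq (n : ℕ) (j : Fin n) (f : Hspace n → ℝ) (p : Hspace n) :
    Xd n j f p = fderiv ℝ f p (Pi.single j 1, 0, 2 * p.2.1 j) := by
  have : ((Pi.single j 1, 0, 2 * p.2.1 j) : Hspace n)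
      = (Pi.single j 1, 0, 0) + (2 * p.2.1 j) • (0, 0, 1) := by
    ext <;> simp
  rw [this, map_add, map_smul]; simp [Xd]

lemma Yd_eq (n : ℕ) (j : Fin n) (f : Hspace n → ℝ) (p : Hspace n) :
    Yd n j f p = fderiv ℝ f p (0, Pi.single j 1, -(2 * p.1 j)) := by
  have : ((0, Pi.single j 1, -(2 * p.1 j)) : Hspace n)
      = (0, Pi.single j 1, 0) + (-(2 * p.1 j)) • (0, 0, 1) := by
    ext <;> simp
  rw [this, map_add, map_smul]; simp [Yd]; ring

lemma contDiff_zSq (n : ℕ) : ContDiff ℝ (⊤ : ℕ∞) (zSq n) := by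
  unfold zSq; fun_prop

/-- `ρ⁴` -/
def Af (n : ℕ) (p : Hspace n) : ℝ := (zSq n p) ^ 2 + p.2.2 ^ 2

def af (n : ℕ) (j : Fin n) (p : Hspace n) : ℝ := p.1 j * zSq n p + p.2.1 j * p.2.2
def bf (n : ℕ) (j : Fin n) (p : Hspace n) : ℝ := p.2.1 j * zSq n p - p.1 j * p.2.2

lemma contDiff_Af (n : ℕ) : ContDiff ℝ (⊤ : ℕ∞) (Af n) := by
  have := contDiff_zSq n
  unfold Af; fun_prop
lemma contDiff_af (n : ℕ) (j : Fin n) : ContDiff ℝ (⊤ : ℕ∞) (af n j) := by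
  have := contDiff_zSq n
  unfold af; fun_prop
lemma contDiff_bf (n : ℕ) (j : Fin n) : ContDiff ℝ (⊤ : ℕ∞) (bf n j) := by
  have := contDiff_zSq n
  unfold bf; fun_prop

lemma zSq_nonneg (n : ℕ) (p : Hspace n) : 0 ≤ zSq n p :=
  Finset.sum_nonneg fun _ _ => by positivity

lemma Af_pos (n : ℕ) (p : Hspace n) (hp : p ≠ 0) : 0 < Af n p := by
  have h0 : 0 ≤ Af n p := by unfold Af; positivity
  refine lt_of_le_of_ne h0 fun h => hp ?_
  have h1 : zSq n p = 0 := by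
    unfold Af at h; nlinarith [sq_nonneg (zSq n p), sq_nonneg p.2.2]
  have h2 : p.2.2 = 0 := by
    unfold Af at h; nlinarith [sq_nonneg (zSq n p), sq_nonneg p.2.2]
  have h3 := (Finset.sum_eq_zero_iff_of_nonneg
    (fun j _ => by positivity)).1 h1
  ext j
  · have := h3 j (Finset.mem_univ _)
    simp; nlinarith [sq_nonneg (p.1 j), sq_nonneg (p.2.1 j)]
  · have := h3 j (Finset.mem_univ _)
    simp; nlinarith [sq_nonneg (p.1 j), sq_nonneg (p.2.1 j)]
  · simpa using h2

lemma hx (n : ℕ) (j : Fin n) (p : Hspace n) : HasFDerivAt (fun q : Hspace n => q.1 j)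
    ((ContinuousLinearMap.proj (R := ℝ) (φ := fun _ : Fin n => ℝ) j).comp
      (ContinuousLinearMap.fst ℝ (Fin n → ℝ) ((Fin n → ℝ) × ℝ))) p :=
  ContinuousLinearMap.hasFDerivAt ((ContinuousLinearMap.proj (R := ℝ) (φ := fun _ : Fin n => ℝ) j).comp
      (ContinuousLinearMap.fst ℝ (Fin n → ℝ) ((Fin n → ℝ) × ℝ)))

lemma hy (n : ℕ) (j : Fin n) (p : Hspace n) : HasFDerivAt (fun q : Hspace n => q.2.1 j)
    ((ContinuousLinearMap.proj (R := ℝ) (φ := fun _ : Fin n => ℝ) j).comp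
      ((ContinuousLinearMap.fst ℝ (Fin n → ℝ) ℝ).comp
      (ContinuousLinearMap.snd ℝ (Fin n → ℝ) ((Fin n → ℝ) × ℝ)))) p :=
  ContinuousLinearMap.hasFDerivAt ((ContinuousLinearMap.proj (R := ℝ) (φ := fun _ : Fin n => ℝ) j).comp
      ((ContinuousLinearMap.fst ℝ (Fin n → ℝ) ℝ).comp
      (ContinuousLinearMap.snd ℝ (Fin n → ℝ) ((Fin n → ℝ) × ℝ))))

lemma ht (n : ℕ) (p : Hspace n) : HasFDerivAt (fun q : Hspace n => q.2.2)
      ((ContinuousLinearMap.snd ℝ (Fin n → ℝ) ℝ).comp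
      (ContinuousLinearMap.snd ℝ (Fin n → ℝ) ((Fin n → ℝ) × ℝ))) p :=
  ContinuousLinearMap.hasFDerivAt ((ContinuousLinearMap.snd ℝ (Fin n → ℝ) ℝ).comp
      (ContinuousLinearMap.snd ℝ (Fin n → ℝ) ((Fin n → ℝ) × ℝ)))

lemma fderiv_zSq (n : ℕ) (p v : Hspace n) :
    fderiv ℝ (zSq n) p v = ∑ k, (2 * p.1 k * v.1 k + 2 * p.2.1 k * v.2.1 k) := by
  have h : HasFDerivAt (zSq n) _ p :=
    HasFDerivAt.fun_sum (u := Finset.univ)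
      fun k _ => ((hx n k p).pow 2).add ((hy n k p).pow 2)
  rw [h.fderiv]
  simp

lemma dz (n : ℕ) (p : Hspace n) : HasFDerivAt (zSq n) (fderiv ℝ (zSq n) p) p :=
  ((contDiff_zSq n).differentiable (by simp) p).hasFDerivAt

lemma fderiv_Af (n : ℕ) (p v : Hspace n) :
    fderiv ℝ (Af n) p v = 2 * zSq n p * fderiv ℝ (zSq n) p v + 2 * p.2.2 * v.2.2 := by
  have h : HasFDerivAt (Af n) _ p := ((dz n p).pow 2).add ((ht n p).pow 2)
  rw [h.fderiv]; simp

lemma fderiv_af (n : ℕ) (j : Fin n) (p v : Hspace n) :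
    fderiv ℝ (af n j) p v = p.1 j * fderiv ℝ (zSq n) p v + zSq n p * v.1 j
      + (p.2.1 j * v.2.2 + p.2.2 * v.2.1 j) := by
  have h : HasFDerivAt (af n j) _ p := ((hx n j p).mul (dz n p)).add ((hy n j p).mul (ht n p))
  rw [h.fderiv]; simp

lemma fderiv_bf (n : ℕ) (j : Fin n) (p v : Hspace n) :
    fderiv ℝ (bf n j) p v = p.2.1 j * fderiv ℝ (zSq n) p v + zSq n p * v.2.1 j
      - (p.1 j * v.2.2 + p.2.2 * v.1 j) := by
  have h : HasFDerivAt (bf n j) _ p := ((hy n j p).mul (dz n p)).sub ((hx n j p).mul (ht n p))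
  rw [h.fderiv]; simp

lemma zX (n : ℕ) (j : Fin n) (p : Hspace n) (s : ℝ) :
    fderiv ℝ (zSq n) p (Pi.single j 1, 0, s) = 2 * p.1 j := by
  rw [fderiv_zSq]
  simp [Pi.single_apply]

lemma zY (n : ℕ) (j : Fin n) (p : Hspace n) (s : ℝ) :
    fderiv ℝ (zSq n) p (0, Pi.single j 1, s) = 2 * p.2.1 j := by
  rw [fderiv_zSq]
  simp [Pi.single_apply]

/-- derivative of `φ² A^β f`. -/
lemma fderiv_g (n : ℕ) (φ f : Hspace n → ℝ) (β : ℝ) (p v : Hspace n) (hA : 0 < Af n p)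
    (hφ : DifferentiableAt ℝ φ p) (hf : DifferentiableAt ℝ f p) :
    fderiv ℝ (fun q => φ q ^ 2 * Af n q ^ β * f q) p v =
      2 * φ p * fderiv ℝ φ p v * Af n p ^ β * f p
      + φ p ^ 2 * (β * Af n p ^ (β - 1) * fderiv ℝ (Af n) p v) * f p
      + φ p ^ 2 * Af n p ^ β * fderiv ℝ f p v := by
  have hAd : HasFDerivAt (Af n) (fderiv ℝ (Af n) p) p :=
    ((contDiff_Af n).differentiable (by simp) p).hasFDerivAt
  have h : HasFDerivAt (fun q => φ q ^ 2 * Af n q ^ β * f q) _ p :=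
    ((hφ.hasFDerivAt.pow 2).mul (hAd.rpow_const (p := β) (Or.inl hA.ne'))).mul hf.hasFDerivAt
  rw [h.fderiv]; simp; ring

lemma contDiff_g (n : ℕ) (φ f : Hspace n → ℝ) (β : ℝ)
    (hφ : ContDiff ℝ (⊤ : ℕ∞) φ) (h0 : (0 : Hspace n) ∉ tsupport φ)
    (hf : ContDiff ℝ (⊤ : ℕ∞) f) :
    ContDiff ℝ (⊤ : ℕ∞) (fun q => φ q ^ 2 * Af n q ^ β * f q) := by
  rw [contDiff_iff_contDiffAt]
  intro p
  by_cases hp : p ∈ tsupport φ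
  · have hA : Af n p ≠ 0 := (Af_pos n p fun h => h0 (h ▸ hp)).ne'
    exact ((hφ.contDiffAt.pow 2).mul
      ((contDiff_Af n).contDiffAt.rpow_const_of_ne hA)).mul hf.contDiffAt
  · have : (fun q => φ q ^ 2 * Af n q ^ β * f q) =ᶠ[nhds p] fun _ => 0 := by
      filter_upwards [notMem_tsupport_iff_eventuallyEq.1 hp] with q hq
      simp [hq]
    exact contDiffAt_const.congr_of_eventuallyEq this

lemma cs_g (n : ℕ) (φ f : Hspace n → ℝ) (β : ℝ) (hcs : HasCompactSupport φ) :
    HasCompactSupport (fun q => φ q ^ 2 * Af n q ^ β * f q) := by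
  refine hcs.mono fun q hq => ?_
  contrapose! hq
  simp at hq ⊢
  simp [hq]

instance (n : ℕ) : (volume : Measure (Hspace n)).IsAddHaarMeasure := by
  have : (volume : Measure (Hspace n)) = (volume : Measure (Fin n → ℝ)).prod
    ((volume : Measure (Fin n → ℝ)).prod (volume : Measure ℝ)) := rfl
  rw [this]
  have h2 : ((volume : Measure (Fin n → ℝ)).prod (volume : Measure ℝ)).IsAddHaarMeasure :=
    Measure.prod.instIsAddHaarMeasure _ _
  exact Measure.prod.instIsAddHaarMeasure _ _

lemma int_dir (n : ℕ) (h g : Hspace n → ℝ) (v : Hspace n)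
    (hh : ContDiff ℝ (⊤ : ℕ∞) h) (hv : ∀ p, fderiv ℝ h p v = 0)
    (hg : ContDiff ℝ (⊤ : ℕ∞) g) (hcs : HasCompactSupport g) :
    Integrable (fun p => h p * fderiv ℝ g p v) ∧ ∫ p, h p * fderiv ℝ g p v = 0 := by
  have c1 : Continuous (fun p => fderiv ℝ g p v) :=
    (hg.continuous_fderiv (by simp)).clm_apply continuous_const
  have s1 : HasCompactSupport (fun p => fderiv ℝ g p v) := hcs.fderiv_apply ℝ v
  have i1 : Integrable (fun p => h p * fderiv ℝ g p v) :=
    (hh.continuous.mul c1).integrable_of_hasCompactSupport s1.mul_left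
  refine ⟨i1, ?_⟩
  rw [integral_mul_fderiv_eq_neg_fderiv_mul_of_integrable (f := h) (g := g) (v := v)]
  · simp [hv]
  · simp [hv]
  · exact i1
  · exact (hh.continuous.mul hg.continuous).integrable_of_hasCompactSupport hcs.mul_left
  · intro p _; exact hh.differentiable (by simp) p
  · intro p _; exact hg.differentiable (by simp) p

lemma int_X (n : ℕ) (j : Fin n) (g : Hspace n → ℝ)
    (hg : ContDiff ℝ (⊤ : ℕ∞) g) (hcs : HasCompactSupport g) :
    Integrable (Xd n j g) ∧ ∫ p, Xd n j g p = 0 := by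
  obtain ⟨a1, a2⟩ := int_dir n (fun _ => 1) g (Pi.single j 1, 0, 0) contDiff_const
    (by simp) hg hcs
  obtain ⟨b1, b2⟩ := int_dir n (fun p => 2 * p.2.1 j) g (0, 0, 1) (by fun_prop)
    (by intro p; rw [((hy n j p).const_mul 2).fderiv]; simp) hg hcs
  have e : Xd n j g = fun p => 1 * fderiv ℝ g p (Pi.single j 1, 0, 0)
    + 2 * p.2.1 j * fderiv ℝ g p (0, 0, 1) := by
    ext p; simp [Xd]
  rw [e]
  exact ⟨a1.add b1, by rw [integral_add a1 b1, a2, b2, add_zero]⟩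

lemma int_Y (n : ℕ) (j : Fin n) (g : Hspace n → ℝ)
    (hg : ContDiff ℝ (⊤ : ℕ∞) g) (hcs : HasCompactSupport g) :
    Integrable (Yd n j g) ∧ ∫ p, Yd n j g p = 0 := by
  obtain ⟨a1, a2⟩ := int_dir n (fun _ => 1) g (0, Pi.single j 1, 0) contDiff_const
    (by simp) hg hcs
  obtain ⟨b1, b2⟩ := int_dir n (fun p => 2 * p.1 j) g (0, 0, 1) (by fun_prop)
    (by intro p; rw [((hx n j p).const_mul 2).fderiv]; simp) hg hcs
  have e : Yd n j g = fun p => 1 * fderiv ℝ g p (0, Pi.single j 1, 0)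
    - 2 * p.1 j * fderiv ℝ g p (0, 0, 1) := by
    ext p; simp [Yd]
  rw [e]
  exact ⟨a1.sub b1, by rw [integral_sub a1 b1, a2, b2, sub_zero]⟩

lemma rho_rpow (n : ℕ) (p : Hspace n) (s : ℝ) : rho n p ^ s = Af n p ^ (s / 4) := by
  have h0 : 0 ≤ Af n p := by unfold Af; positivity
  change (Af n p ^ ((4 : ℝ)⁻¹)) ^ s = _
  rw [← Real.rpow_mul h0]; congr 1; ring

lemma XYg (n : ℕ) (j : Fin n) (φ : Hspace n → ℝ) (β : ℝ) (p : Hspace n) (hA : 0 < Af n p)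
    (hφ : DifferentiableAt ℝ φ p) :
    Xd n j (fun q => φ q ^ 2 * Af n q ^ β * af n j q) p
     + Yd n j (fun q => φ q ^ 2 * Af n q ^ β * bf n j q) p =
     2 * φ p * Af n p ^ β * (Xd n j φ p * af n j p + Yd n j φ p * bf n j p)
     + φ p ^ 2 * Af n p ^ β * (4 * β * (p.1 j ^ 2 + p.2.1 j ^ 2)
        + 2 * zSq n p + 4 * (p.1 j ^ 2 + p.2.1 j ^ 2)) := by
  have e : Af n p ^ β = Af n p ^ (β - 1) * Af n p := by
    rw [← Real.rpow_add_one hA.ne']; congr 1; ring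
  rw [Xd_eq, Yd_eq, fderiv_g n φ _ β p _ hA hφ ((contDiff_af n j).differentiable (by simp) p),
    fderiv_g n φ _ β p _ hA hφ ((contDiff_bf n j).differentiable (by simp) p),
    fderiv_Af, fderiv_Af, fderiv_af, fderiv_bf, zX, zY, ← Xd_eq, ← Yd_eq, e]
  simp only [Pi.single_eq_same, Pi.zero_apply, af, bf]
  generalize Af n p ^ (β - 1) = w
  unfold Af
  ring

lemma sum_ab (n : ℕ) (p : Hspace n) :
    ∑ j, (af n j p ^ 2 + bf n j p ^ 2) = zSq n p * Af n p := by
  conv_rhs => rw [zSq, Finset.sum_mul]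
  refine Finset.sum_congr rfl fun j _ => ?_
  unfold af bf Af; ring

lemma ptwise (n : ℕ) (φ : Hspace n → ℝ) (α c : ℝ) (hc : 2 * c = 2 * n + α)
    (hφ : ContDiff ℝ (⊤ : ℕ∞) φ) (h0 : (0 : Hspace n) ∉ tsupport φ) (p : Hspace n) :
    c ^ 2 * (rho n p ^ (α - 4) * zSq n p * φ p ^ 2)
     - c * ∑ j, (Xd n j (fun q => φ q ^ 2 * Af n q ^ ((α - 4) / 4) * af n j q) p
       + Yd n j (fun q => φ q ^ 2 * Af n q ^ ((α - 4) / 4) * bf n j q) p)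
     ≤ rho n p ^ α * gradH2 n φ p := by
  by_cases hp : p ∈ tsupport φ
  · have hA : 0 < Af n p := Af_pos n p fun h => h0 (h ▸ hp)
    rw [Finset.sum_congr rfl fun j _ =>
      XYg n j φ ((α - 4) / 4) p hA (hφ.differentiable (by simp) p)]
    rw [rho_rpow, rho_rpow]
    have e : Af n p ^ (α / 4) = Af n p ^ ((α - 4) / 4) * Af n p := by
      rw [← Real.rpow_add_one hA.ne']; congr 1; ring
    rw [e]
    have hw : 0 < Af n p ^ ((α - 4) / 4) := Real.rpow_pos_of_pos hA _
    generalize Af n p ^ ((α - 4) / 4) = w at *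
    have key : 0 ≤ ∑ j, ((Af n p * Xd n j φ p + c * φ p * af n j p) ^ 2
        + (Af n p * Yd n j φ p + c * φ p * bf n j p) ^ 2) :=
      Finset.sum_nonneg fun _ _ => by positivity
    have key2 : ∑ j, ((Af n p * Xd n j φ p + c * φ p * af n j p) ^ 2
        + (Af n p * Yd n j φ p + c * φ p * bf n j p) ^ 2) =
        Af n p ^ 2 * gradH2 n φ p + 2 * c * φ p * Af n p *
          ∑ j, (Xd n j φ p * af n j p + Yd n j φ p * bf n j p)
        + c ^ 2 * φ p ^ 2 * (zSq n p * Af n p) := by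
      rw [← sum_ab, gradH2, Finset.mul_sum, Finset.mul_sum, Finset.mul_sum,
        ← Finset.sum_add_distrib, ← Finset.sum_add_distrib]
      exact Finset.sum_congr rfl fun j _ => by ring
    have s2 : ∑ j : Fin n, (4 * ((α - 4) / 4) * (p.1 j ^ 2 + p.2.1 j ^ 2)
        + 2 * zSq n p + 4 * (p.1 j ^ 2 + p.2.1 j ^ 2)) = 2 * c * zSq n p := by
      rw [Finset.sum_add_distrib, Finset.sum_add_distrib, ← Finset.mul_sum,
        ← Finset.mul_sum (f := fun j => p.1 j ^ 2 + p.2.1 j ^ 2) (a := (4 : ℝ))]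
      change 4 * ((α - 4) / 4) * zSq n p + _ + 4 * zSq n p = _
      simp only [Finset.sum_const, Finset.card_univ, Fintype.card_fin, nsmul_eq_mul]
      rw [hc]; ring
    rw [Finset.sum_add_distrib, ← Finset.mul_sum, ← Finset.mul_sum, s2]
    rw [key2] at key
    set S := ∑ j, (Xd n j φ p * af n j p + Yd n j φ p * bf n j p)
    have k3 : 0 ≤ Af n p * gradH2 n φ p + 2 * c * φ p * S + c ^ 2 * φ p ^ 2 * zSq n p := by
      refine nonneg_of_mul_nonneg_right (a := Af n p) ?_ hA
      linarith
    have k4 := mul_nonneg hw.le k3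
    linarith
  · have hz : φ =ᶠ[nhds p] fun _ => 0 := notMem_tsupport_iff_eventuallyEq.1 hp
    have hg : ∀ f : Hspace n → ℝ,
        fderiv ℝ (fun q => φ q ^ 2 * Af n q ^ ((α - 4) / 4) * f q) p = 0 := by
      intro f
      have : (fun q => φ q ^ 2 * Af n q ^ ((α - 4) / 4) * f q) =ᶠ[nhds p] fun _ => 0 := by
        filter_upwards [hz] with q hq
        simp [hq]
      rw [this.fderiv_eq]; simp
    have hr : 0 ≤ rho n p ^ α * gradH2 n φ p := by
      refine mul_nonneg (Real.rpow_nonneg ?_ _) (Finset.sum_nonneg fun _ _ => by positivity)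
      unfold rho; positivity
    have e0 : φ p = 0 := hz.eq_of_nhds
    simp only [Xd_eq, Yd_eq, hg, e0]
    simpa using hr

lemma ofReal_int_le {n : ℕ} (f : Hspace n → ℝ) (hf : Integrable f) :
    ENNReal.ofReal (∫ p, f p) ≤ ∫⁻ p, ENNReal.ofReal (f p) := by
  rw [integral_eq_lintegral_pos_part_sub_lintegral_neg_part hf]
  refine (ENNReal.ofReal_le_ofReal (sub_le_self _ ENNReal.toReal_nonneg)).trans ?_
  exact ENNReal.ofReal_toReal_le

/-- the sharp weighted Hardy inequality on the Heisenberg group ℍⁿ: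
`∫ ρ^α |∇_ℍ φ|² ≥ ((Q + α − 2)/2)² ∫ ρ^{α−4} |z|² φ²` for `φ ∈ C_c^∞(ℝ^{2n+1} \ {0})`. -/
theorem heisenberg_weighted_hardy (n : ℕ) (hn : 1 ≤ n) (Q α : ℝ) (hQ : Q = 2 * n + 2)
    (φ : Hspace n → ℝ) (hφ : ContDiff ℝ (⊤ : ℕ∞) φ) (hcs : HasCompactSupport φ)
    (h0 : (0 : Hspace n) ∉ tsupport φ) :
    (∫⁻ p, ENNReal.ofReal (rho n p ^ α * gradH2 n φ p)) ≥
      ENNReal.ofReal (((Q + α - 2) / 2) ^ 2) *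
        ∫⁻ p, ENNReal.ofReal (rho n p ^ (α - 4) * zSq n p * (φ p) ^ 2) := by
  set c := (Q + α - 2) / 2 with hcdef
  have hc : 2 * c = 2 * n + α := by rw [hcdef, hQ]; ring
  have hX := fun j => int_X n j _ (contDiff_g n φ (af n j) ((α - 4) / 4) hφ h0 (contDiff_af n j))
    (cs_g n φ (af n j) ((α - 4) / 4) hcs)
  have hY := fun j => int_Y n j _ (contDiff_g n φ (bf n j) ((α - 4) / 4) hφ h0 (contDiff_bf n j))
    (cs_g n φ (bf n j) ((α - 4) / 4) hcs)
  have iG : Integrable (fun p => c ^ 2 * (rho n p ^ (α - 4) * zSq n p * φ p ^ 2)) := by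
    refine Integrable.const_mul ?_ _
    have := (contDiff_g n φ (zSq n) ((α - 4) / 4) hφ h0
      (contDiff_zSq n)).continuous.integrable_of_hasCompactSupport (μ := volume)
      (cs_g n φ (zSq n) ((α - 4) / 4) hcs)
    refine this.congr (Filter.Eventually.of_forall fun p => ?_)
    simp only [rho_rpow]; ring
  have iD : Integrable (fun p => c * ∑ j,
      (Xd n j (fun q => φ q ^ 2 * Af n q ^ ((α - 4) / 4) * af n j q) p
       + Yd n j (fun q => φ q ^ 2 * Af n q ^ ((α - 4) / 4) * bf n j q) p)) :=
    (integrable_finsetSum _ fun j _ => (hX j).1.add (hY j).1).const_mul _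
  have zD : ∫ p, c * ∑ j,
      (Xd n j (fun q => φ q ^ 2 * Af n q ^ ((α - 4) / 4) * af n j q) p
       + Yd n j (fun q => φ q ^ 2 * Af n q ^ ((α - 4) / 4) * bf n j q) p) = 0 := by
    rw [integral_const_mul, integral_finsetSum]
    swap
    · intro j _
      exact (hX j).1.add (hY j).1
    rw [Finset.sum_eq_zero, mul_zero]
    intro j _
    rw [integral_add (hX j).1 (hY j).1, (hX j).2, (hY j).2, add_zero]
  have gn : ∀ p, 0 ≤ c ^ 2 * (rho n p ^ (α - 4) * zSq n p * φ p ^ 2) := by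
    intro p
    have h1 := zSq_nonneg n p
    have h2 : 0 ≤ rho n p := by unfold rho; positivity
    positivity
  rw [ge_iff_le, ← lintegral_const_mul' _ _ ENNReal.ofReal_ne_top]
  simp_rw [← ENNReal.ofReal_mul (sq_nonneg c)]
  rw [← ofReal_integral_eq_lintegral_ofReal iG (Filter.Eventually.of_forall gn)]
  have := ofReal_int_le _ (iG.sub iD)
  simp only [Pi.sub_apply] at this
  rw [integral_sub iG iD, zD, sub_zero] at this
  refine this.trans (lintegral_mono fun p => ENNReal.ofReal_le_ofReal ?_)
  exact ptwise n φ α c hc hφ h0 p
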